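/- Assume 𝔄 acts trivially on 𝒜 from the left and that 𝒜/J has a left identity. If the Banach algebra 𝒜 is biprojective, then 𝒜 is module biprojective as an 𝔄-module. -/

import Mathlib

noncomputable section

open scoped Topology

universe u u₁ u₂ u₃ v w

/-- The smallest closed two-sided ideal (realized as a `ℂ`-submodule which is topologically
closed and stable under multiplication by arbitrary elements) containing a given set. -/
def closedIdealGen {R : Type u} [NonUnitalNormedRing R] [NormedSpace ℂ R] (s : Set R) :
    Submodule ℂ R :=
  sInf {p : Submodule ℂ R |
    s ⊆ (p : Set R) ∧ IsClosed (p : Set R) ∧ ∀ x ∈ p, ∀ y : R, x * y ∈ p ∧ y * x ∈ p}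

/-- Data exhibiting the Banach space `TB` as the projective tensor product `B ⊗̂ B` of a
Banach algebra `B` with itself. -/
structure TensorSquareSetting (B : Type u) (TB : Type v)
    [NonUnitalNormedRing B] [NormedSpace ℂ B] [CompleteSpace B]
    [NonUnitalNormedRing TB] [NormedSpace ℂ TB] [CompleteSpace TB] where
  tp : B → B → TB
  tp_add_left : ∀ a b c, tp (a + b) c = tp a c + tp b c
  tp_add_right : ∀ a b c, tp a (b + c) = tp a b + tp a c
  tp_smul_left : ∀ (z : ℂ) a b, tp (z • a) b = z • tp a b
  tp_smul_right : ∀ (z : ℂ) a b, tp a (z • b) = z • tp a b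
  tp_norm : ∀ a b, ‖tp a b‖ ≤ ‖a‖ * ‖b‖
  tp_mul : ∀ a b c d, tp a b * tp c d = tp (a * c) (b * d)
  tp_dense :
    Dense ((Submodule.span ℂ (Set.range fun p : B × B => tp p.1 p.2) : Submodule ℂ TB) : Set TB)
  tp_universal : ∀ {X : Type w} [NormedAddCommGroup X] [NormedSpace ℂ X] [CompleteSpace X]
      (φ : B →L[ℂ] B →L[ℂ] X),
      ∃ ψ : TB →L[ℂ] X, ‖ψ‖ ≤ ‖φ‖ ∧ ∀ a b, ψ (tp a b) = φ a b
  lmul : B → TB →L[ℂ] TB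
  rmul : B → TB →L[ℂ] TB
  lmul_tp : ∀ a b c, lmul a (tp b c) = tp (a * b) c
  rmul_tp : ∀ a b c, rmul a (tp b c) = tp b (c * a)
  ω : TB →L[ℂ] B
  ω_tp : ∀ a b, ω (tp a b) = a * b

/-- A Banach algebra `B` is biprojective if the multiplication map
`ω : B ⊗̂ B → B` has a bounded right inverse which is a `B`-bimodule homomorphism. -/
def TensorSquareSetting.Biprojective {B : Type u} {TB : Type v}
    [NonUnitalNormedRing B] [NormedSpace ℂ B] [CompleteSpace B]
    [NonUnitalNormedRing TB] [NormedSpace ℂ TB] [CompleteSpace TB]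
    (ts : TensorSquareSetting B TB) : Prop :=
  ∃ ρ : B →L[ℂ] TB,
    (∀ a b, ρ (a * b) = ts.lmul a (ρ b)) ∧
    (∀ a b, ρ (b * a) = ts.rmul a (ρ b)) ∧
    (∀ a, ts.ω (ρ a) = a)

/-- A Banach algebra `B` is biflat if the adjoint `ω* : B* → (B ⊗̂ B)*` of the multiplication
map has a bounded left inverse which is a `B`-bimodule homomorphism (for the dual actions
`a · f = f(· a)` and `f · a = f(a ·)`). -/
def TensorSquareSetting.Biflat {B : Type u} {TB : Type v}
    [NonUnitalNormedRing B] [NormedSpace ℂ B] [CompleteSpace B]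
    [NonUnitalNormedRing TB] [NormedSpace ℂ TB] [CompleteSpace TB]
    [IsScalarTower ℂ B B] [SMulCommClass ℂ B B]
    (ts : TensorSquareSetting B TB) : Prop :=
  ∃ θ : (TB →L[ℂ] ℂ) →L[ℂ] (B →L[ℂ] ℂ),
    (∀ (a : B) (f : TB →L[ℂ] ℂ),
      θ (f.comp (ts.rmul a)) = (θ f).comp ((ContinuousLinearMap.mul ℂ B).flip a)) ∧
    (∀ (a : B) (f : TB →L[ℂ] ℂ),
      θ (f.comp (ts.lmul a)) = (θ f).comp (ContinuousLinearMap.mul ℂ B a)) ∧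
    (∀ g : B →L[ℂ] ℂ, θ (g.comp ts.ω) = g)

/-- Compatible bounded bimodule actions of a Banach algebra `𝔄` on a Banach algebra `𝒜`:
`lsmul α a = α · a` and `rsmul α a = a · α`, with `α · (a b) = (α · a) b` and
`(a b) · α = a (b · α)`. -/
structure ActionSetting (𝔄 : Type u₁) (𝒜 : Type u)
    [NonUnitalNormedRing 𝔄] [NormedSpace ℂ 𝔄] [CompleteSpace 𝔄]
    [NonUnitalNormedRing 𝒜] [NormedSpace ℂ 𝒜] [CompleteSpace 𝒜] where
  lsmul : 𝔄 → 𝒜 →L[ℂ] 𝒜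
  rsmul : 𝔄 → 𝒜 →L[ℂ] 𝒜
  lsmul_add : ∀ α β, lsmul (α + β) = lsmul α + lsmul β
  lsmul_smulc : ∀ (z : ℂ) α, lsmul (z • α) = z • lsmul α
  rsmul_add : ∀ α β, rsmul (α + β) = rsmul α + rsmul β
  rsmul_smulc : ∀ (z : ℂ) α, rsmul (z • α) = z • rsmul α
  lsmul_bound : ∃ C : ℝ, ∀ α, ‖lsmul α‖ ≤ C * ‖α‖
  rsmul_bound : ∃ C : ℝ, ∀ α, ‖rsmul α‖ ≤ C * ‖α‖
  lsmul_mulA : ∀ α β a, lsmul (α * β) a = lsmul α (lsmul β a)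
  rsmul_mulA : ∀ α β a, rsmul (α * β) a = rsmul β (rsmul α a)
  lsmul_rsmul : ∀ α β a, rsmul β (lsmul α a) = lsmul α (rsmul β a)
  lsmul_compat : ∀ α a b, lsmul α (a * b) = lsmul α a * b
  rsmul_compat : ∀ α a b, rsmul α (a * b) = a * rsmul α b

/-- The full setting of the paper: `𝒜` is a Banach algebra with compatible `𝔄`-actions,
`T = 𝒜 ⊗̂ 𝒜` is its projective tensor square carrying the induced `𝔄`-actions
(`tlsmul α (a ⊗ b) = (α·a) ⊗ b`, `trsmul α (a ⊗ b) = a ⊗ (b·α)`), `I ⊆ T` is the closed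
ideal generated by the elements `α·a ⊗ b - a ⊗ b·α`, `J ⊆ 𝒜` is the closed ideal generated
by `ω(I)`, and the induced bounded operators on the quotient Banach spaces
`T ⧸ I = 𝒜 ⊗̂_𝔄 𝒜` and `𝒜 ⧸ J` are recorded: `qω` is the induced multiplication map `ω̃`,
`qlsmul/qrsmul` (resp. `qtlsmul/qtrsmul`) are the induced `𝔄`-actions on `𝒜 ⧸ J`
(resp. `T ⧸ I`), and `qmulL/qmulR` (resp. `qlmul/qrmul`) are the induced `𝒜`- (hence
`𝒜/J`-) bimodule actions on `𝒜 ⧸ J` (resp. `T ⧸ I`). -/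
structure ModuleSetting (𝔄 : Type u₁) (𝒜 : Type u) (T : Type v)
    [NonUnitalNormedRing 𝔄] [NormedSpace ℂ 𝔄] [CompleteSpace 𝔄]
    [NonUnitalNormedRing 𝒜] [NormedSpace ℂ 𝒜] [CompleteSpace 𝒜]
    [NonUnitalNormedRing T] [NormedSpace ℂ T] [CompleteSpace T] extends
    TensorSquareSetting 𝒜 T, ActionSetting 𝔄 𝒜 where
  tlsmul : 𝔄 → T →L[ℂ] T
  trsmul : 𝔄 → T →L[ℂ] T
  tlsmul_tp : ∀ α a b, tlsmul α (tp a b) = tp (lsmul α a) b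
  trsmul_tp : ∀ α a b, trsmul α (tp a b) = tp a (rsmul α b)
  I : Submodule ℂ T
  J : Submodule ℂ 𝒜
  hI : I = closedIdealGen
    {x : T | ∃ (α : 𝔄) (a b : 𝒜), x = tlsmul α (tp a b) - trsmul α (tp a b)}
  hJ : J = closedIdealGen (ω '' I)
  qω : (T ⧸ I) →L[ℂ] (𝒜 ⧸ J)
  qω_mk : ∀ t, qω (Submodule.Quotient.mk t) = Submodule.Quotient.mk (ω t)
  qlsmul : 𝔄 → (𝒜 ⧸ J) →L[ℂ] (𝒜 ⧸ J)
  qrsmul : 𝔄 → (𝒜 ⧸ J) →L[ℂ] (𝒜 ⧸ J)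
  qlsmul_mk : ∀ α a, qlsmul α (Submodule.Quotient.mk a) = Submodule.Quotient.mk (lsmul α a)
  qrsmul_mk : ∀ α a, qrsmul α (Submodule.Quotient.mk a) = Submodule.Quotient.mk (rsmul α a)
  qmulL : 𝒜 → (𝒜 ⧸ J) →L[ℂ] (𝒜 ⧸ J)
  qmulR : 𝒜 → (𝒜 ⧸ J) →L[ℂ] (𝒜 ⧸ J)
  qmulL_mk : ∀ a b, qmulL a (Submodule.Quotient.mk b) = Submodule.Quotient.mk (a * b)
  qmulR_mk : ∀ a b, qmulR a (Submodule.Quotient.mk b) = Submodule.Quotient.mk (b * a)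
  qtlsmul : 𝔄 → (T ⧸ I) →L[ℂ] (T ⧸ I)
  qtrsmul : 𝔄 → (T ⧸ I) →L[ℂ] (T ⧸ I)
  qtlsmul_mk : ∀ α t, qtlsmul α (Submodule.Quotient.mk t) = Submodule.Quotient.mk (tlsmul α t)
  qtrsmul_mk : ∀ α t, qtrsmul α (Submodule.Quotient.mk t) = Submodule.Quotient.mk (trsmul α t)
  qlmul : 𝒜 → (T ⧸ I) →L[ℂ] (T ⧸ I)
  qrmul : 𝒜 → (T ⧸ I) →L[ℂ] (T ⧸ I)
  qlmul_mk : ∀ a t, qlmul a (Submodule.Quotient.mk t) = Submodule.Quotient.mk (lmul a t)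
  qrmul_mk : ∀ a t, qrmul a (Submodule.Quotient.mk t) = Submodule.Quotient.mk (rmul a t)

namespace ModuleSetting

variable {𝔄 : Type u₁} {𝒜 : Type u} {T : Type v}
    [NonUnitalNormedRing 𝔄] [NormedSpace ℂ 𝔄] [CompleteSpace 𝔄]
    [NonUnitalNormedRing 𝒜] [NormedSpace ℂ 𝒜] [CompleteSpace 𝒜]
    [NonUnitalNormedRing T] [NormedSpace ℂ T] [CompleteSpace T]

/-- `𝒜` is module biprojective (as an `𝔄`-module) if the induced multiplication map
`ω̃ : 𝒜 ⊗̂_𝔄 𝒜 → 𝒜 ⧸ J` has a bounded right inverse which is an `𝒜/J`-`𝔄`-module morphism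
(a bounded additive map commuting with the `𝔄`-actions and the `𝒜/J`-bimodule actions). -/
def ModuleBiprojective (S : ModuleSetting 𝔄 𝒜 T) : Prop :=
  ∃ ρ : (𝒜 ⧸ S.J) → (T ⧸ S.I),
    (∀ x y, ρ (x + y) = ρ x + ρ y) ∧
    (∃ C : ℝ, ∀ x, ‖ρ x‖ ≤ C * ‖x‖) ∧
    (∀ α x, ρ (S.qlsmul α x) = S.qtlsmul α (ρ x)) ∧
    (∀ α x, ρ (S.qrsmul α x) = S.qtrsmul α (ρ x)) ∧
    (∀ a x, ρ (S.qmulL a x) = S.qlmul a (ρ x)) ∧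
    (∀ a x, ρ (S.qmulR a x) = S.qrmul a (ρ x)) ∧
    (∀ x, S.qω (ρ x) = x)

/-- `𝒜` is module biflat (as an `𝔄`-module) if the adjoint
`ω̃* : (𝒜 ⧸ J)* → (𝒜 ⊗̂_𝔄 𝒜)*` has a bounded left inverse which is an `𝒜/J`-`𝔄`-module
morphism (for the dual actions). -/
def ModuleBiflat (S : ModuleSetting 𝔄 𝒜 T) : Prop :=
  ∃ θ : ((T ⧸ S.I) →L[ℂ] ℂ) → ((𝒜 ⧸ S.J) →L[ℂ] ℂ),
    (∀ f g, θ (f + g) = θ f + θ g) ∧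
    (∃ C : ℝ, ∀ f, ‖θ f‖ ≤ C * ‖f‖) ∧
    (∀ α f, θ (f.comp (S.qtrsmul α)) = (θ f).comp (S.qrsmul α)) ∧
    (∀ α f, θ (f.comp (S.qtlsmul α)) = (θ f).comp (S.qlsmul α)) ∧
    (∀ a f, θ (f.comp (S.qrmul a)) = (θ f).comp (S.qmulR a)) ∧
    (∀ a f, θ (f.comp (S.qlmul a)) = (θ f).comp (S.qmulL a)) ∧
    (∀ g : (𝒜 ⧸ S.J) →L[ℂ] ℂ, θ (g.comp S.qω) = g)

/-- `𝔄` acts trivially on `𝒜` from the left, via the continuous functional `f`: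
`α · a = f(α) a`. -/
def TrivialLeftAction (S : ModuleSetting 𝔄 𝒜 T) (f : 𝔄 →L[ℂ] ℂ) : Prop :=
  ∀ α a, S.lsmul α a = f α • a

/-- The quotient algebra `𝒜 ⧸ J` has a left identity `e + J`. -/
def HasLeftIdentity (S : ModuleSetting 𝔄 𝒜 T) : Prop :=
  ∃ e : 𝒜, ∀ x : 𝒜 ⧸ S.J, S.qmulL e x = x

/-- The quotient algebra `𝒜 ⧸ J` has an identity `e + J`. -/
def HasIdentity (S : ModuleSetting 𝔄 𝒜 T) : Prop :=
  ∃ e : 𝒜, ∀ x : 𝒜 ⧸ S.J, S.qmulL e x = x ∧ S.qmulR e x = x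

/-- `𝔄` has a bounded approximate identity for `𝒜`: a bounded net `(α_j)` in `𝔄` with
`‖α_j · a - a‖ → 0` and `‖a · α_j - a‖ → 0` for every `a ∈ 𝒜`. -/
def HasBoundedApproximateIdentityFor (S : ModuleSetting 𝔄 𝒜 T) : Prop :=
  ∃ C : ℝ, 0 < C ∧ ∀ ε : ℝ, 0 < ε → ∀ F : Finset 𝒜, ∃ α : 𝔄, ‖α‖ ≤ C ∧
    ∀ a ∈ F, ‖S.lsmul α a - a‖ < ε ∧ ‖S.rsmul α a - a‖ < ε

/-- The quotient algebra `𝒜 ⧸ J` has a bounded approximate identity. -/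
def QuotientHasBoundedApproximateIdentity (S : ModuleSetting 𝔄 𝒜 T) : Prop :=
  ∃ C : ℝ, 0 < C ∧ ∀ ε : ℝ, 0 < ε → ∀ F : Finset (𝒜 ⧸ S.J), ∃ e : 𝒜,
    ‖(Submodule.Quotient.mk e : 𝒜 ⧸ S.J)‖ ≤ C ∧
    ∀ x ∈ F, ‖S.qmulL e x - x‖ < ε ∧ ‖S.qmulR e x - x‖ < ε

/-- `𝒜 ⧸ J` is a commutative `𝔄`-module. -/
def QuotientCommutative (S : ModuleSetting 𝔄 𝒜 T) : Prop :=
  ∀ (α : 𝔄) (x : 𝒜 ⧸ S.J), S.qlsmul α x = S.qrsmul α x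

end ModuleSetting

variable {𝔄 : Type u₁} {𝒜 : Type u} {T : Type v}
  [NonUnitalNormedRing 𝔄] [NormedSpace ℂ 𝔄] [CompleteSpace 𝔄]
  [NonUnitalNormedRing 𝒜] [NormedSpace ℂ 𝒜] [CompleteSpace 𝒜]
  [NonUnitalNormedRing T] [NormedSpace ℂ T] [CompleteSpace T]

section ClosedIdeal

variable {R : Type u} [NonUnitalNormedRing R] [NormedSpace ℂ R]

theorem subset_closedIdealGen (s : Set R) : s ⊆ closedIdealGen s := fun _ hx =>
  Submodule.mem_sInf.2 fun _ hp => hp.1 hx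

theorem isClosed_closedIdealGen (s : Set R) : IsClosed (closedIdealGen s : Set R) := by
  rw [closedIdealGen, Submodule.coe_sInf]
  exact isClosed_biInter fun p hp => hp.2.1

theorem closedIdealGen_mul_mem {s : Set R} {x : R} (hx : x ∈ closedIdealGen s) (y : R) :
    x * y ∈ closedIdealGen s ∧ y * x ∈ closedIdealGen s := by
  simp only [closedIdealGen, Submodule.mem_sInf] at hx ⊢
  exact ⟨fun p hp => (hp.2.2 x (hx p hp) y).1, fun p hp => (hp.2.2 x (hx p hp) y).2⟩

theorem closedIdealGen_le {s : Set R} {p : Submodule ℂ R} (hs : s ⊆ p)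
    (hc : IsClosed (p : Set R)) (hm : ∀ x ∈ p, ∀ y : R, x * y ∈ p ∧ y * x ∈ p) :
    closedIdealGen s ≤ p :=
  sInf_le ⟨hs, hc, hm⟩

end ClosedIdeal

/-- A closed additive predicate holding on scalar multiples of elements of `s` holds on the
closed linear span of `s`. -/
theorem topologicalClosure_span_induction {E : Type*} [NormedAddCommGroup E] [NormedSpace ℂ E]
    {s : Set E} {p : E → Prop} (closed : IsClosed {x | p x}) (zero : p 0)
    (add : ∀ x y, p x → p y → p (x + y)) (smul : ∀ (z : ℂ), ∀ x ∈ s, p (z • x))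
    {x : E} (hx : x ∈ (Submodule.span ℂ s).topologicalClosure) : p x := by
  refine closure_minimal (t := {x | p x}) (fun y hy => ?_) closed hx
  induction hy using Submodule.closure_induction with
  | zero => exact zero
  | add x y _ _ hx hy => exact add x y hx hy
  | smul_mem r x h => exact smul r x h

namespace TensorSquareSetting

variable (ts : TensorSquareSetting 𝒜 T)

theorem mul_smul_eq (ts : TensorSquareSetting 𝒜 T) (z : ℂ) (a b : 𝒜) : a * (z • b) = z • (a * b) := by
  rw [← ts.ω_tp, ts.tp_smul_right, map_smul, ts.ω_tp]

/-- The map `b ↦ a ⊗ b` as a continuous linear map. -/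
def tpRight (a : 𝒜) : 𝒜 →L[ℂ] T :=
  LinearMap.mkContinuous
    { toFun := ts.tp a
      map_add' := ts.tp_add_right a
      map_smul' := fun z b => ts.tp_smul_right z a b } ‖a‖ (ts.tp_norm a)

/-- The map `a ↦ a ⊗ b` as a continuous linear map. -/
def tpLeft (b : 𝒜) : 𝒜 →L[ℂ] T :=
  LinearMap.mkContinuous
    { toFun := fun a => ts.tp a b
      map_add' := fun a c => ts.tp_add_left a c b
      map_smul' := fun z a => ts.tp_smul_left z a b } ‖b‖
    fun a => (ts.tp_norm a b).trans_eq (mul_comm _ _)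

theorem tp_sub_right (a b c : 𝒜) : ts.tp a (b - c) = ts.tp a b - ts.tp a c :=
  map_sub (ts.tpRight a) b c

theorem induction {p : T → Prop} (closed : IsClosed {x | p x}) (zero : p 0)
    (add : ∀ x y, p x → p y → p (x + y)) (tp : ∀ a b, p (ts.tp a b)) (t : T) : p t := by
  refine topologicalClosure_span_induction
    (s := Set.range fun p : 𝒜 × 𝒜 => ts.tp p.1 p.2) closed zero add ?_ (ts.tp_dense t)
  rintro z _ ⟨⟨a, b⟩, rfl⟩
  simpa only [ts.tp_smul_left] using tp (z • a) b

/-- In a biprojective Banach algebra the products span a dense subspace. -/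
theorem mem_of_mul_mem (h : ts.Biprojective) {P : Submodule ℂ 𝒜} (hP : IsClosed (P : Set 𝒜))
    (hmul : ∀ a b, a * b ∈ P) (a : 𝒜) : a ∈ P := by
  obtain ⟨ρ, -, -, hρ⟩ := h
  rw [← hρ a]
  refine ts.induction (p := fun t => ts.ω t ∈ P) (hP.preimage ts.ω.continuous) ?_ ?_ ?_ (ρ a)
  · simp
  · intro x y hx hy
    simpa using P.add_mem hx hy
  · intro a b
    simpa only [ts.ω_tp] using hmul a b

/-- The closed linear span of the elementary tensors whose right factor lies in `P`. -/
def tensorRight (P : Submodule ℂ 𝒜) : Submodule ℂ T :=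
  (Submodule.span ℂ {t | ∃ a, ∃ x ∈ P, t = ts.tp a x}).topologicalClosure

variable {ts} {P : Submodule ℂ 𝒜}

theorem tp_mem_tensorRight (a : 𝒜) {x : 𝒜} (hx : x ∈ P) : ts.tp a x ∈ ts.tensorRight P :=
  Submodule.le_topologicalClosure _ (Submodule.subset_span ⟨a, x, hx, rfl⟩)

theorem isClosed_tensorRight : IsClosed (ts.tensorRight P : Set T) :=
  Submodule.isClosed_topologicalClosure _

theorem tensorRight_induction {p : T → Prop} (closed : IsClosed {x | p x}) (zero : p 0)
    (add : ∀ x y, p x → p y → p (x + y)) (tp : ∀ a, ∀ x ∈ P, p (ts.tp a x))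
    {t : T} (ht : t ∈ ts.tensorRight P) : p t := by
  refine topologicalClosure_span_induction closed zero add ?_ ht
  rintro z _ ⟨a, x, hx, rfl⟩
  simpa only [ts.tp_smul_left] using tp (z • a) x hx

theorem tensorRight_mul_mem (hP : ∀ x ∈ P, ∀ y, x * y ∈ P ∧ y * x ∈ P) {t : T}
    (ht : t ∈ ts.tensorRight P) (s : T) :
    t * s ∈ ts.tensorRight P ∧ s * t ∈ ts.tensorRight P := by
  refine ts.induction
    (p := fun s => t * s ∈ ts.tensorRight P ∧ s * t ∈ ts.tensorRight P) ?_ ?_ ?_ ?_ s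
  · exact (isClosed_tensorRight.preimage (continuous_const_mul t)).inter
      (isClosed_tensorRight.preimage (continuous_mul_const t))
  · simp
  · intro x y hx hy
    simpa only [mul_add, add_mul] using ⟨add_mem hx.1 hy.1, add_mem hx.2 hy.2⟩
  intro c d
  refine tensorRight_induction (p := fun t =>
    t * ts.tp c d ∈ ts.tensorRight P ∧ ts.tp c d * t ∈ ts.tensorRight P) ?_ ?_ ?_ ?_ ht
  · exact (isClosed_tensorRight.preimage (continuous_mul_const _)).inter
      (isClosed_tensorRight.preimage (continuous_const_mul _))
  · simp
  · intro x y hx hy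
    simpa only [mul_add, add_mul] using ⟨add_mem hx.1 hy.1, add_mem hx.2 hy.2⟩
  · intro a x hx
    simp only [ts.tp_mul]
    exact ⟨tp_mem_tensorRight _ (hP x hx d).1, tp_mem_tensorRight _ (hP x hx d).2⟩

/-- A continuous linear map sending `a ⊗ x` into a closed subspace for all `x ∈ P` sends all of
`𝒜 ⊗̂ P` into it. -/
theorem map_mem_of_mem_tensorRight {E : Type*} [NormedAddCommGroup E] [NormedSpace ℂ E]
    (g : T →L[ℂ] E) {Q : Submodule ℂ E} (hQ : IsClosed (Q : Set E))
    (h : ∀ a, ∀ x ∈ P, g (ts.tp a x) ∈ Q) {t : T} (ht : t ∈ ts.tensorRight P) : g t ∈ Q := by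
  refine tensorRight_induction (p := fun t => g t ∈ Q) (hQ.preimage g.continuous) ?_ ?_ h ht
  · simp
  · intro x y hx hy
    simpa using Q.add_mem hx hy

variable (ts)

/-- A continuous linear map sending elementary tensors into a closed subspace has range in it. -/
theorem map_mem {E : Type*} [NormedAddCommGroup E] [NormedSpace ℂ E]
    (g : T →L[ℂ] E) {Q : Submodule ℂ E} (hQ : IsClosed (Q : Set E))
    (h : ∀ a b, g (ts.tp a b) ∈ Q) (t : T) : g t ∈ Q := by
  refine ts.induction (p := fun t => g t ∈ Q) (hQ.preimage g.continuous) ?_ ?_ h t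
  · simp
  · intro x y hx hy
    simpa using Q.add_mem hx hy

end TensorSquareSetting

namespace ModuleSetting

open TensorSquareSetting

variable (S : ModuleSetting 𝔄 𝒜 T)

theorem isClosed_I : IsClosed (S.I : Set T) := by
  rw [S.hI]
  exact isClosed_closedIdealGen _

theorem isClosed_J : IsClosed (S.J : Set 𝒜) := by
  rw [S.hJ]
  exact isClosed_closedIdealGen _

theorem I_mul_mem {x : T} (hx : x ∈ S.I) (y : T) : x * y ∈ S.I ∧ y * x ∈ S.I := by
  rw [S.hI] at hx ⊢
  exact closedIdealGen_mul_mem hx y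

theorem ω_mem_J {t : T} (ht : t ∈ S.I) : S.ω t ∈ S.J := by
  rw [S.hJ]
  exact subset_closedIdealGen _ ⟨t, ht, rfl⟩

variable {S} {f : 𝔄 →L[ℂ] ℂ}

theorem TrivialLeftAction.tp_sub_mem_I (hf : S.TrivialLeftAction f) (α : 𝔄) (a b : 𝒜) :
    S.tp a (f α • b - S.rsmul α b) ∈ S.I := by
  rw [S.hI]
  refine subset_closedIdealGen _ ⟨α, a, b, ?_⟩
  rw [S.tlsmul_tp, S.trsmul_tp, hf, S.tp_smul_left, tp_sub_right, S.tp_smul_right]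

theorem TrivialLeftAction.sub_mem_J (hf : S.TrivialLeftAction f)
    (h : S.toTensorSquareSetting.Biprojective) (α : 𝔄) (b : 𝒜) :
    f α • b - S.rsmul α b ∈ S.J := by
  let g : 𝒜 →L[ℂ] 𝒜 := f α • ContinuousLinearMap.id ℂ 𝒜 - S.rsmul α
  refine S.mem_of_mul_mem h (P := S.J.comap g.toLinearMap)
    (S.isClosed_J.preimage g.continuous) (fun c d => ?_) b
  have := S.ω_mem_J (hf.tp_sub_mem_I α c d)
  rw [S.ω_tp, mul_sub, S.mul_smul_eq, ← S.rsmul_compat] at this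
  exact this

variable (S) in
/-- The subspace of those `x` with `𝒜 ⊗ x ⊆ I`. -/
def rightAnnihilated : Submodule ℂ 𝒜 :=
  ⨅ a : 𝒜, S.I.comap (S.tpRight a).toLinearMap

theorem mem_rightAnnihilated {x : 𝒜} : x ∈ S.rightAnnihilated ↔ ∀ a, S.tp a x ∈ S.I := by
  simp only [rightAnnihilated, Submodule.mem_iInf]
  rfl

theorem isClosed_rightAnnihilated : IsClosed (S.rightAnnihilated : Set 𝒜) := by
  rw [rightAnnihilated, Submodule.coe_iInf]
  exact isClosed_iInter fun a => S.isClosed_I.preimage (S.tpRight a).continuous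

theorem rightAnnihilated_mul_mem (h : S.toTensorSquareSetting.Biprojective) (x : 𝒜)
    (hx : x ∈ S.rightAnnihilated) (y : 𝒜) :
    x * y ∈ S.rightAnnihilated ∧ y * x ∈ S.rightAnnihilated := by
  rw [mem_rightAnnihilated] at hx
  have key (z : 𝒜) (hz : ∀ c d, S.tp (c * d) z ∈ S.I) : z ∈ S.rightAnnihilated :=
    mem_rightAnnihilated.2 <| S.mem_of_mul_mem h (P := S.I.comap (S.tpLeft z).toLinearMap)
      (S.isClosed_I.preimage (S.tpLeft z).continuous) hz
  refine ⟨key _ fun c d => ?_, key _ fun c d => ?_⟩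
  · rw [← S.tp_mul]
    exact (S.I_mul_mem (hx c) _).1
  · rw [← S.tp_mul]
    exact (S.I_mul_mem (hx d) _).2

theorem tensorRight_rightAnnihilated_le : S.tensorRight S.rightAnnihilated ≤ S.I := fun _ ht =>
  map_mem_of_mem_tensorRight (ContinuousLinearMap.id ℂ T) S.isClosed_I
    (fun a _ hx => mem_rightAnnihilated.1 hx a) ht

theorem TrivialLeftAction.I_eq (hf : S.TrivialLeftAction f)
    (h : S.toTensorSquareSetting.Biprojective) : S.I = S.tensorRight S.rightAnnihilated := by
  refine le_antisymm ?_ tensorRight_rightAnnihilated_le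
  rw [S.hI]
  refine closedIdealGen_le ?_ isClosed_tensorRight
    fun t ht s => tensorRight_mul_mem (rightAnnihilated_mul_mem h) ht s
  rintro _ ⟨α, a, b, rfl⟩
  rw [S.tlsmul_tp, S.trsmul_tp, hf, S.tp_smul_left, ← S.tp_smul_right, ← tp_sub_right]
  exact tp_mem_tensorRight a (mem_rightAnnihilated.2 fun c => hf.tp_sub_mem_I α c b)

theorem TrivialLeftAction.J_le (hf : S.TrivialLeftAction f)
    (h : S.toTensorSquareSetting.Biprojective) {P : Submodule ℂ 𝒜} (hc : IsClosed (P : Set 𝒜))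
    (hm : ∀ x ∈ P, ∀ y, x * y ∈ P ∧ y * x ∈ P) (hP : ∀ a, ∀ x ∈ S.rightAnnihilated, a * x ∈ P) :
    S.J ≤ P := by
  rw [S.hJ]
  refine closedIdealGen_le ?_ hc hm
  rintro _ ⟨t, ht, rfl⟩
  rw [SetLike.mem_coe, hf.I_eq h] at ht
  exact map_mem_of_mem_tensorRight S.ω hc (fun a x hx => by simpa only [S.ω_tp] using hP a x hx) ht

theorem TrivialLeftAction.map_J_mem_I (hf : S.TrivialLeftAction f)
    (h : S.toTensorSquareSetting.Biprojective) {ρ : 𝒜 →L[ℂ] T}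
    (hl : ∀ a b, ρ (a * b) = S.lmul a (ρ b)) (hr : ∀ a b, ρ (b * a) = S.rmul a (ρ b)) :
    S.J ≤ S.I.comap ρ.toLinearMap := by
  refine hf.J_le h (S.isClosed_I.preimage ρ.continuous) ?_ ?_
  · intro x hx y
    simp only [Submodule.mem_comap, ContinuousLinearMap.coe_coe] at hx ⊢
    rw [hl y x, hr y x]
    rw [hf.I_eq h] at hx ⊢
    refine ⟨map_mem_of_mem_tensorRight _ isClosed_tensorRight (fun a z hz => ?_) hx,
      map_mem_of_mem_tensorRight _ isClosed_tensorRight (fun a z hz => ?_) hx⟩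
    · rw [S.rmul_tp]
      exact tp_mem_tensorRight a (rightAnnihilated_mul_mem h z hz y).1
    · rw [S.lmul_tp]
      exact tp_mem_tensorRight (y * a) hz
  · intro a x hx
    simp only [Submodule.mem_comap, ContinuousLinearMap.coe_coe]
    rw [hr]
    refine S.map_mem (S.rmul x) S.isClosed_I (fun c d => ?_) _
    rw [S.rmul_tp]
    exact mem_rightAnnihilated.1 (rightAnnihilated_mul_mem h x hx d).2 c

theorem TrivialLeftAction.tlsmul_eq (hf : S.TrivialLeftAction f) (α : 𝔄) (t : T) :
    S.tlsmul α t = f α • t := by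
  have := S.map_mem (S.tlsmul α - f α • ContinuousLinearMap.id ℂ T) (Q := ⊥)
    (by simp) (fun a b => by simp [S.tlsmul_tp, hf α a, S.tp_smul_left]) t
  simpa [sub_eq_zero] using this

theorem TrivialLeftAction.sub_trsmul_mem_I (hf : S.TrivialLeftAction f) (α : 𝔄) (t : T) :
    f α • t - S.trsmul α t ∈ S.I := by
  refine S.map_mem (f α • ContinuousLinearMap.id ℂ T - S.trsmul α) S.isClosed_I
    (fun a b => ?_) t
  have := hf.tp_sub_mem_I α a b
  rw [tp_sub_right, S.tp_smul_right, ← S.trsmul_tp] at this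
  exact this

end ModuleSetting

/-- Proposition 2.4.
Assume `𝔄` acts trivially on `𝒜` from the left and `𝒜 ⧸ J` has a left identity.
If the Banach algebra `𝒜` is biprojective, then `𝒜` is module biprojective
(as an `𝔄`-module). -/
theorem stmt1 (S : ModuleSetting 𝔄 𝒜 T) (f : 𝔄 →L[ℂ] ℂ)
    (hf : S.TrivialLeftAction f)
    (hid : S.HasLeftIdentity)
    (hbiproj : S.toTensorSquareSetting.Biprojective) :
    S.ModuleBiprojective := by
  obtain ⟨ρ, hl, hr, hω⟩ := id hbiproj
  have hJ := hf.map_J_mem_I hbiproj hl hr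
  have mk_rsmul (α : 𝔄) (a : 𝒜) :
      (Submodule.Quotient.mk (S.rsmul α a) : 𝒜 ⧸ S.J) = Submodule.Quotient.mk (f α • a) :=
    ((Submodule.Quotient.eq _).2 (hf.sub_mem_J hbiproj α a)).symm
  have mk_trsmul (α : 𝔄) (t : T) :
      (Submodule.Quotient.mk (S.trsmul α t) : T ⧸ S.I) = Submodule.Quotient.mk (f α • t) :=
    ((Submodule.Quotient.eq _).2 (hf.sub_trsmul_mem_I α t)).symm
  refine ⟨S.J.mapQ S.I ρ.toLinearMap hJ, map_add _, ⟨‖ρ‖, fun x => ?_⟩, fun α x => ?_,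
    fun α x => ?_, fun a x => ?_, fun a x => ?_, fun x => ?_⟩
  · refine le_of_forall_pos_le_add fun ε hε => ?_
    obtain ⟨a, rfl, ha⟩ := Submodule.Quotient.norm_mk_lt x
      (show 0 < ε / (‖ρ‖ + 1) by positivity)
    calc _ ≤ ‖ρ a‖ := Submodule.Quotient.norm_mk_le S.I (ρ a)
      _ ≤ ‖ρ‖ * ‖a‖ := ρ.le_opNorm a
      _ ≤ ‖ρ‖ * (‖(Submodule.Quotient.mk a : 𝒜 ⧸ S.J)‖ + ε / (‖ρ‖ + 1)) := by gcongr
      _ ≤ _ := by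
        rw [mul_add]
        gcongr
        rw [mul_div_left_comm]
        exact mul_le_of_le_one_right hε.le ((div_le_one (by positivity)).2 (by linarith))
  all_goals obtain ⟨b, rfl⟩ := Submodule.Quotient.mk_surjective _ x
  · rw [S.qlsmul_mk, ← Submodule.mkQ_apply, ← Submodule.mkQ_apply]
    simp [hf α b, hf.tlsmul_eq, ← Submodule.Quotient.mk_smul, S.qtlsmul_mk]
  · rw [S.qrsmul_mk, mk_rsmul]
    change Submodule.Quotient.mk (ρ (f α • b)) = S.qtrsmul α (Submodule.Quotient.mk (ρ b))
    rw [S.qtrsmul_mk, mk_trsmul, map_smul]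
  · rw [S.qmulL_mk]
    change Submodule.Quotient.mk (ρ (a * b)) = S.qlmul a (Submodule.Quotient.mk (ρ b))
    rw [S.qlmul_mk, hl]
  · rw [S.qmulR_mk]
    change Submodule.Quotient.mk (ρ (b * a)) = S.qrmul a (Submodule.Quotient.mk (ρ b))
    rw [S.qrmul_mk, hr]
  · change S.qω (Submodule.Quotient.mk (ρ b)) = _
    rw [S.qω_mk, hω]
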